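/- Under the standing hypotheses, if g ∈ G and n is an integer with g^n ∈ A, then g ∈ A or g^n = 1. -/

import Mathlib

/-- An involution: an element of order 2. -/
def IsInvol {G : Type*} [Group G] (s : G) : Prop := orderOf s = 2

/-- `s₁ ∼_j s₂`: there are nonzero integers `m, n` with `(j·s₁)^m = (j·s₂)^n`. -/
def JEquiv {G : Type*} [Group G] (j s₁ s₂ : G) : Prop :=
  ∃ m n : ℤ, m ≠ 0 ∧ n ≠ 0 ∧ (j * s₁) ^ m = (j * s₂) ^ n

/-- `s₁` is minimal relative to `j`: `⟨j, s₂⟩ ≤ ⟨j, s₁⟩` for every involution `s₂ ∼_j s₁`. -/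
def JMinimal {G : Type*} [Group G] (j s₁ : G) : Prop :=
  ∀ s₂ : G, IsInvol s₂ → JEquiv j s₂ s₁ →
    Subgroup.closure ({j, s₂} : Set G) ≤ Subgroup.closure ({j, s₁} : Set G)

/-- The standing hypotheses (1)–(6) on `G`, `j`, `t`, `t'`. -/
structure StandingHyp {G : Type*} [Group G] (j t t' : G) : Prop where
  invol_j : IsInvol j
  invol_t : IsInvol t
  invol_t' : IsInvol t'
  tconj : t' * j * t' = t
  all_conj : ∀ s₁ s₂ : G, IsInvol s₁ → IsInvol s₂ → IsConj s₁ s₂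
  infinite_order : ∀ r s : G, IsInvol r → IsInvol s → r ≠ s → ¬ IsOfFinOrder (r * s)
  unique_root : ∀ n : ℕ, 0 < n → ∃! s : G, IsInvol s ∧ (j * s) ^ n = j * t
  conj_in_A : ∀ s : G, IsInvol s → JEquiv j s t →
      ∃ a ∈ Subgroup.centralizer ({j} : Set G), a⁻¹ * t * a = s
  centralizer_eq : ∀ s : G, IsInvol s → s ≠ j → ∀ x : G,
      x ∈ Subgroup.centralizer ({j * s} : Set G) ↔
        x = 1 ∨ ∃ s' : G, IsInvol s' ∧ JEquiv j s' s ∧ x = j * s'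
  unique_minimal : ∀ s : G, IsInvol s →
      ¬ (∃ a ∈ Subgroup.centralizer ({j} : Set G),
           ∃ b ∈ Subgroup.centralizer ({j} : Set G), s = a * t * b) →
      ∃! s' : G, IsInvol s' ∧ JEquiv j s' s ∧ JMinimal j s'

/-- In a group where distinct involutions have a product of infinite order, commuting
involutions are equal. -/
theorem IsInvol.eq_of_commute {G : Type*} [Group G] {r s : G} (hr : IsInvol r) (hs : IsInvol s)
    (hinf : r ≠ s → ¬ IsOfFinOrder (r * s)) (h : Commute r s) : r = s := by
  by_contra hne
  refine hinf hne (isOfFinOrder_iff_pow_eq_one.mpr ⟨2, two_pos, ?_⟩)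
  have hr2 : r ^ 2 = 1 := hr ▸ pow_orderOf_eq_one r
  have hs2 : s ^ 2 = 1 := hs ▸ pow_orderOf_eq_one s
  rw [h.mul_pow, hr2, hs2, one_mul]

/-- A conjugate of an involution is an involution. -/
theorem IsInvol.conj {G : Type*} [Group G] {s : G} (hs : IsInvol s) (g : G) :
    IsInvol (g * s * g⁻¹) := by
  have h := (MulAut.conj g).orderOf_eq s
  rw [MulAut.conj_apply] at h
  exact h.trans hs

/-- if `g^n ∈ A` then `g ∈ A` or `g^n = 1`. -/
theorem pow_mem_centralizer {G : Type*} [Group G] (j t t' : G)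
    (H : StandingHyp j t t') (g : G) (n : ℤ)
    (hg : g ^ n ∈ Subgroup.centralizer ({j} : Set G)) :
    g ∈ Subgroup.centralizer ({j} : Set G) ∨ g ^ n = 1 := by
  have hj : Commute j (g ^ n) := Subgroup.mem_centralizer_singleton_iff.mp hg |>.symm
  by_cases hne : g * j * g⁻¹ = j
  · exact .inl (Subgroup.mem_centralizer_singleton_iff.mpr (mul_inv_eq_iff_eq_mul.mp hne))
  right
  have hgg : Commute g (g ^ n) := Commute.self_zpow g n
  have hc : Commute (j * (g * j * g⁻¹)) (g ^ n) :=
    hj.mul_left ((hgg.mul_left hj).mul_left hgg.inv_left)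
  rcases (H.centralizer_eq _ (H.invol_j.conj g) hne (g ^ n)).mp
    (Subgroup.mem_centralizer_singleton_iff.mpr hc.symm) with h | ⟨s, hs, -, h⟩
  · exact h
  have hjs : Commute j s := by
    have := (Commute.refl j).inv_right.mul_right hj
    rwa [h, inv_mul_cancel_left] at this
  obtain rfl := H.invol_j.eq_of_commute hs (H.infinite_order j s H.invol_j hs) hjs
  have hj2 : j ^ 2 = 1 := orderOf_dvd_iff_pow_eq_one.mp H.invol_j.dvd
  rw [h, ← sq, hj2]
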